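/- Every probabilistic function computed by a probabilistic Turing machine is probabilistic recursive: PC ⊆ PR (modulo a fixed computable bijection between ℕ and Σ*). -/

import Mathlib

noncomputable section
open scoped Classical

/-- A pseudodistribution on ℕ: pointwise nonnegative, summable, with total mass at most 1. -/
def IsPseudoDist (D : ℕ → ℝ) : Prop :=
  (∀ n, 0 ≤ D n) ∧ Summable D ∧ ∑' n, D n ≤ 1

/-- Generalized composition:
(f ⊙ (g₁,…,gₙ))(x⃗)(y) = ∑_{z⃗} f(z⃗)(y) · ∏ᵢ gᵢ(x⃗)(zᵢ). -/
noncomputable def genComp {n k : ℕ} (f : (Fin n → ℕ) → ℕ → ℝ)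
    (g : Fin n → (Fin k → ℕ) → ℕ → ℝ) : (Fin k → ℕ) → ℕ → ℝ :=
  fun x y => ∑' z : Fin n → ℕ, f z y * ∏ i, g i x (z i)

/-- Auxiliary for primitive recursion: h(x⃗,0) = f(x⃗),
h(x⃗,y+1)(w) = ∑_z g(x⃗,y,z)(w) · h(x⃗,y)(z). -/
noncomputable def primRecAux {k : ℕ} (f : (Fin k → ℕ) → ℕ → ℝ)
    (g : (Fin (k + 2) → ℕ) → ℕ → ℝ) (x : Fin k → ℕ) : ℕ → ℕ → ℝ
  | 0 => f x
  | y + 1 => fun w =>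
      ∑' z : ℕ, g (Fin.snoc (Fin.snoc x y) z) w * primRecAux f g x y z

/-- Primitive recursion of probabilistic functions, as a function on ℕ^(k+1). -/
noncomputable def primRec {k : ℕ} (f : (Fin k → ℕ) → ℕ → ℝ)
    (g : (Fin (k + 2) → ℕ) → ℕ → ℝ) : (Fin (k + 1) → ℕ) → ℕ → ℝ :=
  fun v => primRecAux f g (Fin.init v) (v (Fin.last k))

/-- Minimization: (μf)(x⃗)(y) = f(x⃗,y)(0) · ∏_{z<y} (∑_{k>0} f(x⃗,z)(k)). -/
noncomputable def minimize {k : ℕ} (f : (Fin (k + 1) → ℕ) → ℕ → ℝ) :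
    (Fin k → ℕ) → ℕ → ℝ :=
  fun x y =>
    f (Fin.snoc x y) 0 *
      ∏ z ∈ Finset.range y, ∑' m : {m : ℕ // 0 < m}, f (Fin.snoc x z) (m : ℕ)

/-- The class PR of probabilistic recursive functions: the smallest class of
probabilistic functions containing the basic probabilistic functions (zero,
successor, projections, fair coin) and closed under generalized composition,
primitive recursion and minimization. -/
inductive PR : {k : ℕ} → ((Fin k → ℕ) → ℕ → ℝ) → Prop where
  /-- The zero function z(n) = Dirac(0). -/
  | zero : PR (fun (_ : Fin 1 → ℕ) (y : ℕ) => if y = 0 then (1 : ℝ) else 0)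
  /-- The successor function s(n) = Dirac(n+1). -/
  | succ : PR (fun (x : Fin 1 → ℕ) (y : ℕ) => if y = x 0 + 1 then (1 : ℝ) else 0)
  /-- The projections Πⁿₘ(x⃗) = Dirac(xₘ). -/
  | proj {n : ℕ} (m : Fin n) :
      PR (fun (x : Fin n → ℕ) (y : ℕ) => if y = x m then (1 : ℝ) else 0)
  /-- The fair coin r(x), assigning probability 1/2 to each of x and x+1. -/
  | coin : PR (fun (x : Fin 1 → ℕ) (y : ℕ) =>
      if y = x 0 ∨ y = x 0 + 1 then (1 : ℝ) / 2 else 0)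
  /-- Closure under generalized composition. -/
  | comp {n k : ℕ} {f : (Fin n → ℕ) → ℕ → ℝ} {g : Fin n → (Fin k → ℕ) → ℕ → ℝ} :
      PR f → (∀ i, PR (g i)) → PR (genComp f g)
  /-- Closure under primitive recursion. -/
  | primrec {k : ℕ} {f : (Fin k → ℕ) → ℕ → ℝ} {g : (Fin (k + 2) → ℕ) → ℕ → ℝ} :
      PR f → PR g → PR (primRec f g)
  /-- Closure under minimization. -/
  | minim {k : ℕ} {f : (Fin (k + 1) → ℕ) → ℕ → ℝ} :
      PR f → PR (minimize f)

/-- Head moves of a Turing machine. -/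
inductive Move where
  | left : Move
  | right : Move

/-- A probabilistic Turing machine over the alphabet A (tape alphabet
`Option A`, where `none` is the blank symbol): a finite set of states with an
initial state and a set of final states, and two transition functions δ₀, δ₁,
each applied with probability 1/2 at each step. A transition reads the current
state and scanned symbol and yields a new state, a symbol to write, and a head
move. -/
structure PTM (A : Type) where
  /-- The set of states. -/
  Q : Type
  /-- The set of states is finite. -/
  [finQ : Fintype Q]
  /-- The initial state. -/
  init : Q
  /-- The final states. -/
  final : Set Q
  /-- The first transition function. -/
  δ₀ : Q → Option A → Q × Option A × Move
  /-- The second transition function. -/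
  δ₁ : Q → Option A → Q × Option A × Move

/-- A configuration of a PTM: tape to the left of the head (nearest symbol
first), scanned symbol, tape to the right of the head, current state. -/
structure Conf {A : Type} (M : PTM A) where
  /-- Tape on the left of the head, nearest symbol first. -/
  left : List (Option A)
  /-- The scanned symbol. -/
  scan : Option A
  /-- Tape on the right of the head. -/
  right : List (Option A)
  /-- The current state. -/
  state : M.Q

/-- A configuration is final when its state is final. -/
def Conf.IsFinal {A : Type} {M : PTM A} (c : Conf M) : Prop := c.state ∈ M.final

/-- Apply a transition function to a configuration: write the symbol, move the
head and change state (fresh blank cells appear at the tape ends when needed). -/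
def applyTrans {A : Type} {M : PTM A}
    (t : M.Q → Option A → M.Q × Option A × Move) (c : Conf M) : Conf M :=
  match t c.state c.scan with
  | (q', b, Move.left) =>
    match c.left with
    | [] => ⟨[], none, b :: c.right, q'⟩
    | x :: l => ⟨l, x, b :: c.right, q'⟩
  | (q', b, Move.right) =>
    match c.right with
    | [] => ⟨b :: c.left, none, [], q'⟩
    | x :: r => ⟨b :: c.left, x, r, q'⟩

/-- The string (over A) written on the tape of a configuration: the tape content
with blanks removed. -/
def outStr {A : Type} {M : PTM A} (c : Conf M) : List A :=
  (c.left.reverse ++ c.scan :: c.right).filterMap id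

/-- The initial configuration for input string s: empty left tape, head on the
first symbol of s, initial state. -/
def initConf {A : Type} (M : PTM A) (s : List A) : Conf M :=
  match s with
  | [] => ⟨[], none, [], M.init⟩
  | a :: v => ⟨[], some a, v.map some, M.init⟩

/-- The one-step functional F_M of the PTM M, acting on functions from
configurations to pseudodistributions on strings: F_M(f)(C) is the Dirac
distribution on the tape string of C if C is final, and
½·f(δ₀(C)) + ½·f(δ₁(C)) otherwise. -/
noncomputable def Fm {A : Type} (M : PTM A)
    (f : Conf M → List A → ℝ) : Conf M → List A → ℝ :=
  fun c s =>
    if c.IsFinal then (if s = outStr c then 1 else 0)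
    else (1 / 2) * f (applyTrans M.δ₀ c) s + (1 / 2) * f (applyTrans M.δ₁ c) s

/-- The least fixpoint of F_M, obtained as the supremum of the ascending chain
of iterates of F_M starting from the everywhere-zero function. -/
noncomputable def lfpFm {A : Type} (M : PTM A) : Conf M → List A → ℝ :=
  fun c s => ⨆ n : ℕ, (Fm M)^[n] (fun _ _ => 0) c s

/-- The probabilistic function IO_M : Σ* → 𝒫(Σ*) computed by the PTM M:
the least fixpoint of F_M evaluated at the initial configuration. -/
noncomputable def IOfun {A : Type} (M : PTM A) : List A → List A → ℝ :=
  fun s => lfpFm M (initConf M s)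

noncomputable instance : Denumerable (List Bool) :=
  Denumerable.ofEncodableOfInfinite (List Bool)

/-- A fixed computable bijection between strings (over the alphabet Bool) and ℕ,
induced by the canonical encoding of List Bool. -/
noncomputable def strNatEquiv : List Bool ≃ ℕ := Denumerable.eqv (List Bool)

/-- PC: the class of (unary) probabilistic functions computed by probabilistic
Turing machines, transported to ℕ along the fixed bijection `strNatEquiv`. -/
def PCfun (f : (Fin 1 → ℕ) → ℕ → ℝ) : Prop :=
  ∃ M : PTM Bool, ∀ (x : Fin 1 → ℕ) (y : ℕ),
    f x y = IOfun M (strNatEquiv.symm (x 0)) (strNatEquiv.symm y)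

/-- The deterministic function `F`, viewed as a probabilistic function. -/
def dirac {k : ℕ} (F : (Fin k → ℕ) → ℕ) : (Fin k → ℕ) → ℕ → ℝ :=
  fun x y => if y = F x then 1 else 0

theorem genComp_dirac {n k : ℕ} (f : (Fin n → ℕ) → ℕ → ℝ) (G : Fin n → (Fin k → ℕ) → ℕ) :
    genComp f (fun i => dirac (G i)) = fun x => f fun i => G i x := by
  funext x y
  have h (z : Fin n → ℕ) : f z y * ∏ i, dirac (G i) x (z i) =
      if z = (fun i => G i x) then f z y else 0 := by
    simp only [dirac, Finset.prod_ite_zero, Finset.prod_const_one, funext_iff, Finset.mem_univ,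
      true_implies]
    split_ifs <;> simp
  simp only [genComp, h, tsum_ite_eq]

namespace PR

theorem comp_dirac {n k : ℕ} {f : (Fin n → ℕ) → ℕ → ℝ} {G : Fin n → (Fin k → ℕ) → ℕ}
    (hf : PR f) (hG : ∀ i, PR (dirac (G i))) : PR fun x => f fun i => G i x :=
  genComp_dirac f G ▸ hf.comp hG

theorem reindex {n k : ℕ} {f : (Fin n → ℕ) → ℕ → ℝ} (hf : PR f) (e : Fin n → Fin k) :
    PR fun x => f (x ∘ e) :=
  hf.comp_dirac (G := fun i x => x (e i)) fun i => .proj (e i)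

end PR

theorem minimize_dirac {k : ℕ} {F : (Fin (k + 1) → ℕ) → ℕ} {G : (Fin k → ℕ) → ℕ}
    (h₀ : ∀ x, F (Fin.snoc x (G x)) = 0) (h₁ : ∀ x, ∀ z < G x, F (Fin.snoc x z) ≠ 0) :
    minimize (dirac F) = dirac G := by
  have hsum (v : Fin (k + 1) → ℕ) :
      ∑' m : {m : ℕ // 0 < m}, dirac F v m = if F v = 0 then 0 else 1 := by
    split_ifs with h
    · simp only [dirac, h]
      exact (tsum_congr fun m => if_neg m.2.ne').trans tsum_zero
    · rw [tsum_eq_single ⟨F v, Nat.pos_of_ne_zero h⟩]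
      · simp [dirac]
      · rintro ⟨m, hm⟩ hne
        exact if_neg fun h => hne (Subtype.ext h)
  funext x y
  simp only [minimize, hsum]
  simp only [dirac]
  rcases lt_trichotomy y (G x) with h | rfl | h
  · rw [if_neg (h₁ x y h).symm, if_neg h.ne, zero_mul]
  · rw [if_pos (h₀ x).symm, if_pos rfl, one_mul]
    exact Finset.prod_eq_one fun z hz => if_neg (h₁ x z (Finset.mem_range.1 hz))
  · rw [if_neg h.ne']
    exact mul_eq_zero_of_right _ (Finset.prod_eq_zero (Finset.mem_range.2 h) (if_pos (h₀ x)))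

theorem primRecAux_dirac {k : ℕ} (F : (Fin k → ℕ) → ℕ) (G : (Fin (k + 2) → ℕ) → ℕ)
    (x : Fin k → ℕ) (n w : ℕ) :
    primRecAux (dirac F) (dirac G) x n w =
      if w = n.rec (F x) (fun y ih => G (Fin.snoc (Fin.snoc x y) ih)) then 1 else 0 := by
  induction n generalizing w with
  | zero => rfl
  | succ n ih => simp only [primRecAux, ih, mul_ite, mul_one, mul_zero, tsum_ite_eq, dirac]

namespace PR

theorem const_zero : ∀ k, PR (dirac fun _ : Fin k → ℕ => 0)
  | 0 => by
    rw [← minimize_dirac (F := fun _ => 0) (fun _ => rfl) (by simp)]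
    exact .minim .zero
  | k + 1 => zero.reindex (k := k + 1) fun _ => 0

theorem of_primrec' {k : ℕ} {F : List.Vector ℕ k → ℕ} (hF : Nat.Primrec' F) :
    PR (dirac fun x => F (List.Vector.ofFn x)) := by
  induction hF with
  | zero => exact const_zero 0
  | succ => exact .succ
  | get i =>
    simp only [List.Vector.get_ofFn]
    exact .proj i
  | comp g hf hg ihf ihg =>
    exact comp_dirac (f := dirac _) (G := fun i x => g i (List.Vector.ofFn x)) ihf ihg
  | @prec n f g hf hg ihf ihg =>
    have hg' := ihg.reindex (k := n + 2)
      (Fin.cons (Fin.last n).castSucc (Fin.cons (Fin.last (n + 1)) fun i => i.castSucc.castSucc))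
    have h := (PR.primrec ihf hg').reindex (k := n + 1) (Fin.snoc Fin.succ 0)
    convert h using 1
    funext x w
    have hs : (x ∘ Fin.snoc Fin.succ 0 : Fin (n + 1) → ℕ) = Fin.snoc (x ∘ Fin.succ) (x 0) := by
      rw [Fin.comp_snoc]
    have e (m ih : ℕ) : List.Vector.ofFn
        ((Fin.snoc (Fin.snoc (x ∘ Fin.succ) m : Fin (n + 1) → ℕ) ih : Fin (n + 2) → ℕ) ∘
        (Fin.cons (Fin.last n).castSucc
          (Fin.cons (Fin.last (n + 1)) fun i => i.castSucc.castSucc))) =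
        m ::ᵥ ih ::ᵥ List.Vector.ofFn (x ∘ Fin.succ) := by
      refine List.Vector.ext fun i => ?_
      rw [List.Vector.get_ofFn]
      refine Fin.cases (by simp) (fun i => Fin.cases ?_ (fun i => by simp) i) i
      rw [List.Vector.get_cons_succ]
      simp
    rw [hs, primRec, Fin.init_snoc, Fin.snoc_last]
    refine Eq.trans ?_ (primRecAux_dirac _ _ _ _ _).symm
    simp only [e]
    rfl

theorem of_primrec {k : ℕ} {F : (Fin k → ℕ) → ℕ} (hF : Primrec F) : PR (dirac F) := by
  have h := of_primrec' (F := fun v => F v.get)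
    (Nat.Primrec'.prim_iff.2 (hF.comp Primrec.vector_get'))
  have hv (x : Fin k → ℕ) : (List.Vector.ofFn x).get = x := funext (List.Vector.get_ofFn x)
  simpa only [hv] using h

/-- Sequential composition: sample `z` from `f x`, then sample from `g (x, z)`. -/
theorem bind {k : ℕ} {f : (Fin k → ℕ) → ℕ → ℝ} {g : (Fin (k + 1) → ℕ) → ℕ → ℝ}
    (hf : PR f) (hg : PR g) : PR fun x w => ∑' z, g (Fin.snoc x z) w * f x z := by
  have h := (hf.primrec (hg.reindex (k := k + 2)
    (Fin.snoc (fun i => i.castSucc.castSucc) (Fin.last (k + 1))))).comp_dirac (k := k)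
    (G := Fin.snoc (fun i x => x i) fun _ => 1) (Fin.lastCases
      (by simpa only [Fin.snoc_last] using of_primrec (.const 1))
      fun i => by simp only [Fin.snoc_castSucc]; exact proj i)
  convert h using 1
  funext x w
  have hx : (fun i => (Fin.snoc (fun i x => x i) fun _ => 1 :
      Fin (k + 1) → (Fin k → ℕ) → ℕ) i x) = Fin.snoc x 1 := by
    funext i
    induction i using Fin.lastCases <;> simp
  have e (m ih : ℕ) : ((Fin.snoc (Fin.snoc x m : Fin (k + 1) → ℕ) ih : Fin (k + 2) → ℕ) ∘
        (Fin.snoc (fun i => i.castSucc.castSucc) (Fin.last (k + 1)))) =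
        (Fin.snoc x ih : Fin (k + 1) → ℕ) := by
    funext i
    induction i using Fin.lastCases <;> simp
  rw [hx, primRec, Fin.init_snoc, Fin.snoc_last]
  simp only [primRecAux, e]

end PR

theorem PR.of_primrec₂ {F : ℕ → ℕ → ℕ} (hF : Primrec₂ F) :
    PR (dirac fun v : Fin 2 → ℕ => F (v 0) (v 1)) :=
  .of_primrec (hF.comp (Primrec.fin_app.comp .id (.const 0)) (Primrec.fin_app.comp .id (.const 1)))

theorem PR.geometric (k : ℕ) : PR fun (_ : Fin k → ℕ) t => (1 / 2 : ℝ) ^ (t + 1) := by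
  have h := (PR.coin.comp_dirac (k := k + 1) fun _ => .const_zero _).minim
  convert h using 1
  funext x t
  have hs : ∑' m : {m : ℕ // 0 < m},
      (if (m : ℕ) = 0 ∨ (m : ℕ) = 0 + 1 then (1 : ℝ) / 2 else 0) = 1 / 2 := by
    rw [tsum_eq_single ⟨1, one_pos⟩]
    · simp
    · rintro ⟨m, hm⟩ hne
      refine if_neg fun h => hne (Subtype.ext ?_)
      change m = 1
      simp only at h
      omega
  simp only [minimize, hs, Finset.prod_const, Finset.card_range, pow_succ]
  simp [mul_comm]

theorem hasSum_half_pow_succ : HasSum (fun t : ℕ => (1 / 2 : ℝ) ^ (t + 1)) 1 := by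
  have h := hasSum_geometric_two.mul_right (1 / 2)
  rw [mul_one_div_cancel two_ne_zero] at h
  simpa only [pow_succ] using h

theorem hasSum_binary_digits {a b : ℕ} (h : a < b) :
    HasSum (fun t : ℕ => ((2 ^ (t + 1) * a / b % 2 : ℕ) : ℝ) * (1 / 2) ^ (t + 1)) (a / b) := by
  rw [hasSum_iff_tendsto_nat_of_nonneg fun t => by positivity]
  have hd (t : ℕ) : ((2 ^ (t + 1) * a / b % 2 : ℕ) : ℝ) * (1 / 2) ^ (t + 1) =
      ((2 ^ (t + 1) * a / b : ℕ) : ℝ) / 2 ^ (t + 1) - ((2 ^ t * a / b : ℕ) : ℝ) / 2 ^ t := by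
    have h₁ : 2 ^ (t + 1) * a / b / 2 = 2 ^ t * a / b := by
      rw [Nat.div_div_eq_div_mul, pow_succ', mul_assoc, mul_comm b,
        Nat.mul_div_mul_left _ _ two_pos]
    have h₂ := Nat.div_add_mod (2 ^ (t + 1) * a / b) 2
    rw [h₁] at h₂
    rw [← h₂]
    push_cast
    simp only [one_div, inv_pow, pow_succ]
    field_simp
    simp
  simp only [hd]
  simp only [Finset.sum_range_sub (fun t => ((2 ^ t * a / b : ℕ) : ℝ) / 2 ^ t)]
  have hfl := (tendsto_nat_floor_mul_div_atTop (R := ℝ) (a := (a : ℝ) / b) (by positivity)).comp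
    (tendsto_pow_atTop_atTop_of_one_lt (one_lt_two : (1 : ℝ) < 2))
  have h0 : a / b = 0 := Nat.div_eq_of_lt h
  simp only [pow_zero, one_mul, h0, Nat.cast_zero, zero_div, sub_zero]
  refine hfl.congr fun t => ?_
  simp only [Function.comp]
  rw [← Nat.floor_div_eq_div (K := ℝ)]
  congr 3
  push_cast
  ring

/-- For `t` geometrically distributed, `digitTest a b t` vanishes with probability `a / b`
(with probability `1` if `b ≤ a`): it tests the `t`-th binary digit of `a / b`. -/
def digitTest (a b t : ℕ) : ℕ :=
  if b ≤ a then 0 else 1 - 2 ^ (t + 1) * a / b % 2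

theorem digitTest_le_one (a b t : ℕ) : digitTest a b t ≤ 1 := by
  unfold digitTest
  split_ifs <;> omega

/-- The distribution of `digitTest a b t` for `t` geometrically distributed. -/
def biasedCoin (a b w : ℕ) : ℝ :=
  ∑' t, (if w = digitTest a b t then 1 else 0) * (1 / 2 : ℝ) ^ (t + 1)

theorem biasedCoin_zero (a b : ℕ) : biasedCoin a b 0 = if b ≤ a then 1 else (a : ℝ) / b := by
  unfold biasedCoin
  split_ifs with h
  · simpa only [digitTest, h, if_true, one_mul] using hasSum_half_pow_succ.tsum_eq
  · rw [← (hasSum_binary_digits (not_le.1 h)).tsum_eq]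
    refine tsum_congr fun t => ?_
    simp only [digitTest, h, if_false]
    rcases Nat.mod_two_eq_zero_or_one (2 ^ (t + 1) * a / b) with h | h <;> simp [h]

theorem tsum_biasedCoin_pos (a b : ℕ) :
    ∑' m : {m : ℕ // 0 < m}, biasedCoin a b m = 1 - biasedCoin a b 0 := by
  have hle := digitTest_le_one a b
  have hs (w : ℕ) : Summable fun t => (if w = digitTest a b t then 1 else 0) *
      (1 / 2 : ℝ) ^ (t + 1) :=
    hasSum_half_pow_succ.summable.of_nonneg_of_le (fun t => by positivity) fun t => by
      split_ifs <;> simp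
  rw [tsum_eq_single ⟨1, one_pos⟩, eq_sub_iff_add_eq, biasedCoin, biasedCoin, ← (hs 1).tsum_add (hs 0)]
  · refine (tsum_congr fun t => ?_).trans hasSum_half_pow_succ.tsum_eq
    rcases Nat.le_one_iff_eq_zero_or_eq_one.1 (hle t) with h | h <;> simp [h]
  · rintro ⟨m, hm⟩ hne
    have hm1 : m ≠ 1 := fun h => hne (Subtype.ext h)
    refine (tsum_congr fun t => ?_).trans tsum_zero
    have := hle t
    rw [if_neg (by simp only; omega), zero_mul]

theorem PR.biased {α β : ℕ → ℕ → ℕ} (hα : Primrec₂ α) (hβ : Primrec₂ β) :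
    PR fun v : Fin 2 → ℕ => biasedCoin (α (v 0) (v 1)) (β (v 0) (v 1)) := by
  have hv (i : Fin 3) : Primrec fun v : Fin 3 → ℕ => v i := Primrec.fin_app.comp .id (.const i)
  have hα' := hα.comp (hv 0) (hv 1)
  have hβ' := hβ.comp (hv 0) (hv 1)
  have hpow : Primrec₂ ((· ^ ·) : ℕ → ℕ → ℕ) := Primrec₂.unpaired'.1 Nat.Primrec.pow
  have hD : Primrec fun v : Fin 3 → ℕ => digitTest (α (v 0) (v 1)) (β (v 0) (v 1)) (v 2) :=
    .ite (Primrec.nat_le.comp hβ' hα') (.const 0) <| Primrec.nat_sub.comp (.const 1) <|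
      Primrec.nat_mod.comp (Primrec.nat_div.comp (Primrec.nat_mul.comp
        (hpow.comp (.const 2) (Primrec.succ.comp (hv 2))) hα') hβ') (.const 2)
  exact (PR.geometric 2).bind (.of_primrec hD)

/-- If `m x y / 2 ^ y` are the weights of a subprobability distribution in `y`, then this is the
weight not yet used by the first `y` values, scaled by `2 ^ y`. -/
def remainingMass (m : ℕ → ℕ → ℕ) (x y : ℕ) : ℕ :=
  y.rec 1 fun z r => 2 * (r - m x z)

theorem primrec_remainingMass {m : ℕ → ℕ → ℕ} (hm : Primrec₂ m) : Primrec₂ (remainingMass m) :=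
  Primrec.nat_rec (.const 1) (Primrec.nat_mul.comp (.const 2) <|
    Primrec.nat_sub.comp (Primrec.snd.comp .snd) (hm.comp .fst (Primrec.fst.comp .snd))).to₂

theorem remainingMass_eq {m : ℕ → ℕ → ℕ} {x : ℕ}
    (hle : ∀ n, ∑ y ∈ Finset.range n, (m x y : ℝ) / 2 ^ y ≤ 1) (n : ℕ) :
    (remainingMass m x n : ℝ) = 2 ^ n * (1 - ∑ y ∈ Finset.range n, (m x y : ℝ) / 2 ^ y) := by
  induction n with
  | zero => simp [remainingMass]
  | succ n ih =>
    have h := hle (n + 1)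
    rw [Finset.sum_range_succ] at h ⊢
    have hp : (0 : ℝ) < 2 ^ n := by positivity
    have e : (remainingMass m x n : ℝ) - m x n =
        2 ^ n * (1 - (∑ y ∈ Finset.range n, (m x y : ℝ) / 2 ^ y + (m x n : ℝ) / 2 ^ n)) := by
      rw [ih]; field_simp; ring
    have hmn : m x n ≤ remainingMass m x n := by
      rw [← Nat.cast_le (α := ℝ), ← sub_nonneg, e]
      exact mul_nonneg hp.le (sub_nonneg.2 h)
    change ((2 * (remainingMass m x n - m x n) : ℕ) : ℝ) = _
    rw [Nat.cast_mul, Nat.cast_sub hmn, e]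
    push_cast
    ring

theorem le_remainingMass {m : ℕ → ℕ → ℕ} {x : ℕ}
    (hle : ∀ n, ∑ y ∈ Finset.range n, (m x y : ℝ) / 2 ^ y ≤ 1) (n : ℕ) :
    m x n ≤ remainingMass m x n := by
  have h := hle (n + 1)
  rw [Finset.sum_range_succ] at h
  rw [← Nat.cast_le (α := ℝ), remainingMass_eq hle, mul_comm, ← div_le_iff₀ (by positivity)]
  linarith

/-- A subprobability distribution with primitive recursive dyadic weights can be sampled: search
for its value, stopping at `y` with the conditional probability of `y` given that the values below
`y` have been rejected. -/
theorem PR.sample {m : ℕ → ℕ → ℕ} (hm : Primrec₂ m)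
    (hle : ∀ x n, ∑ y ∈ Finset.range n, (m x y : ℝ) / 2 ^ y ≤ 1) :
    PR fun (x : Fin 1 → ℕ) y => (m (x 0) y : ℝ) / 2 ^ y := by
  convert (PR.biased hm (primrec_remainingMass hm)).minim using 1
  funext v y
  change _ = biasedCoin (m (v 0) y) (remainingMass m (v 0) y) 0 *
    ∏ z ∈ Finset.range y, ∑' k : {k : ℕ // 0 < k},
      biasedCoin (m (v 0) z) (remainingMass m (v 0) z) k
  generalize v 0 = x
  simp only [tsum_biasedCoin_pos]
  have hcond (n : ℕ) : biasedCoin (m x n) (remainingMass m x n) 0 *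
      (1 - ∑ z ∈ Finset.range n, (m x z : ℝ) / 2 ^ z) = (m x n : ℝ) / 2 ^ n := by
    have hp : (0 : ℝ) < 2 ^ n := by positivity
    have hr := remainingMass_eq (hle x) n
    rw [eq_div_iff hp.ne', mul_assoc, mul_comm (1 - _), ← hr, biasedCoin_zero]
    have hmr := le_remainingMass (hle x) n
    split_ifs with h
    · rw [one_mul, le_antisymm hmr h]
    · have : (remainingMass m x n : ℝ) ≠ 0 := by
        rw [Nat.cast_ne_zero]; omega
      field_simp
  have hprod (n : ℕ) : ∏ z ∈ Finset.range n,
      (1 - biasedCoin (m x z) (remainingMass m x z) 0) =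
      1 - ∑ z ∈ Finset.range n, (m x z : ℝ) / 2 ^ z := by
    induction n with
    | zero => simp
    | succ n ih =>
      rw [Finset.prod_range_succ, ih, Finset.sum_range_succ, ← hcond n]
      ring
  rw [hprod, hcond]

/-- The binary words of length less than `n`. -/
def shortWords : ℕ → Finset (List Bool)
  | 0 => ∅
  | n + 1 => insert [] ((shortWords n).image (false :: ·) ∪ (shortWords n).image (true :: ·))

theorem mem_shortWords {n : ℕ} {w : List Bool} : w ∈ shortWords n ↔ w.length < n := by
  induction n generalizing w with
  | zero => simp [shortWords]
  | succ n ih =>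
    rcases w with _ | ⟨_ | _, w⟩ <;> simp [shortWords, ih]

theorem sum_shortWords_succ (g : List Bool → ℝ) (n : ℕ) :
    ∑ w ∈ shortWords (n + 1), g w = g [] + (∑ w ∈ shortWords n, g (false :: w) +
      ∑ w ∈ shortWords n, g (true :: w)) := by
  have hinj (b : Bool) : Function.Injective (b :: · : List Bool → List Bool) :=
    List.cons_injective
  rw [shortWords, Finset.sum_insert (by simp), Finset.sum_union, Finset.sum_image (hinj _).injOn,
    Finset.sum_image (hinj _).injOn]
  rw [Finset.disjoint_left]
  simp

theorem tendsto_shortWords : Filter.Tendsto shortWords Filter.atTop Filter.atTop :=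
  Filter.tendsto_atTop_finset_of_monotone
    (fun _ _ h _ hw => mem_shortWords.2 ((mem_shortWords.1 hw).trans_le h))
    fun w => ⟨w.length + 1, mem_shortWords.2 w.length.lt_succ_self⟩

section Execution

variable {A : Type} {M : PTM A}

/-- One step of the run of `M` guided by a bit; a halted machine has no next configuration. -/
def guidedStep (o : Option (Conf M)) (b : Bool) : Option (Conf M) :=
  o.bind fun c => if c.IsFinal then none else some (applyTrans (bif b then M.δ₁ else M.δ₀) c)

/-- The output of a configuration, provided that it is final. -/
def finalOutput (c : Conf M) : Option (List A) :=
  if c.IsFinal then some (outStr c) else none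

/-- The output of `M` if it halts after exactly the steps that the word `w` dictates. -/
def guidedRun (c : Conf M) (w : List Bool) : Option (List A) :=
  (w.foldl guidedStep (some c)).bind finalOutput

theorem guidedRun_nil (c : Conf M) : guidedRun c [] = finalOutput c := rfl

theorem guidedRun_cons (c : Conf M) (b : Bool) (w : List Bool) :
    guidedRun c (b :: w) =
      if c.IsFinal then none else guidedRun (applyTrans (bif b then M.δ₁ else M.δ₀) c) w := by
  have hnone : w.foldl guidedStep (none : Option (Conf M)) = none := by
    induction w with
    | nil => rfl
    | cons b w ih => exact ih
  unfold guidedRun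
  split_ifs with h <;> simp [guidedStep, h, hnone]

/-- The expectation of `φ` over the guiding words of length less than `n`. -/
def wordSum (φ : Option (List A) → ℝ) (n : ℕ) (c : Conf M) : ℝ :=
  ∑ w ∈ shortWords n, φ (guidedRun c w) * (1 / 2) ^ w.length

theorem wordSum_succ {φ : Option (List A) → ℝ} (hφ : φ none = 0) (n : ℕ) (c : Conf M) :
    wordSum φ (n + 1) c = if c.IsFinal then φ (some (outStr c)) else
      1 / 2 * wordSum φ n (applyTrans M.δ₀ c) + 1 / 2 * wordSum φ n (applyTrans M.δ₁ c) := by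
  simp only [wordSum, sum_shortWords_succ, guidedRun_nil, guidedRun_cons, finalOutput]
  split_ifs with h
  · simp [hφ]
  · simp only [hφ, List.length_cons, Finset.mul_sum, cond_false, cond_true, zero_mul, zero_add]
    congr 1 <;> exact Finset.sum_congr rfl fun w _ => by ring

theorem wordSum_eq_iterate (n : ℕ) (c : Conf M) (s : List A) :
    wordSum (fun o => if o = some s then 1 else 0) n c = (Fm M)^[n] (fun _ _ => 0) c s := by
  induction n generalizing c with
  | zero => simp [wordSum, shortWords]
  | succ n ih =>
    rw [Function.iterate_succ_apply', wordSum_succ (by simp), Fm, ← ih, ← ih]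
    simp only [Option.some_inj, eq_comm]

theorem wordSum_isSome_le_one (n : ℕ) (c : Conf M) :
    wordSum (fun o => if o.isSome then 1 else 0) n c ≤ 1 := by
  induction n generalizing c with
  | zero => simp [wordSum, shortWords]
  | succ n ih =>
    rw [wordSum_succ (by simp)]
    by_cases h : c.IsFinal
    · simp [h]
    · rw [if_neg h]
      linarith [ih (applyTrans M.δ₀ c), ih (applyTrans M.δ₁ c)]

theorem summable_halting (c : Conf M) : Summable fun w : List Bool =>
    (if (guidedRun c w).isSome then 1 else 0 : ℝ) * (1 / 2) ^ w.length := by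
  refine summable_of_sum_le (c := 1) (fun w => by positivity) fun u => ?_
  obtain ⟨n, hn⟩ := (tendsto_shortWords.eventually_ge_atTop u).exists
  exact (Finset.sum_le_sum_of_subset_of_nonneg hn fun w _ _ => by positivity).trans
    (wordSum_isSome_le_one n c)

theorem tsum_halting_le_one (c : Conf M) : ∑' w : List Bool,
    (if (guidedRun c w).isSome then 1 else 0 : ℝ) * (1 / 2) ^ w.length ≤ 1 :=
  le_of_tendsto ((summable_halting c).hasSum.comp tendsto_shortWords)
    (.of_forall fun n => wordSum_isSome_le_one n c)

theorem tsum_guidedRun (c : Conf M) (s : List A) : ∑' w : List Bool,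
    (if guidedRun c w = some s then 1 else 0 : ℝ) * (1 / 2) ^ w.length = lfpFm M c s := by
  have hs : Summable fun w : List Bool =>
      (if guidedRun c w = some s then 1 else 0 : ℝ) * (1 / 2) ^ w.length :=
    (summable_halting c).of_nonneg_of_le (fun w => by positivity) fun w => by
      gcongr
      split_ifs with h <;> simp_all
  have ht : Filter.Tendsto (fun n => (Fm M)^[n] (fun _ _ => 0) c s) Filter.atTop
      (nhds (∑' w : List Bool,
        (if guidedRun c w = some s then 1 else 0 : ℝ) * (1 / 2) ^ w.length)) := by
    simp only [← wordSum_eq_iterate]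
    exact hs.hasSum.comp tendsto_shortWords
  have hmono : Monotone fun n => (Fm M)^[n] (fun _ _ => 0) c s := fun i j hij => by
    simp only [← wordSum_eq_iterate]
    exact Finset.sum_le_sum_of_subset_of_nonneg
      (fun w hw => mem_shortWords.2 ((mem_shortWords.1 hw).trans_le hij))
      fun w _ _ => by positivity
  exact tendsto_nhds_unique ht (tendsto_atTop_ciSup hmono
    ⟨_, Set.forall_mem_range.2 fun n => hmono.ge_of_tendsto ht n⟩)

end Execution

section Encoding

variable {M : PTM Bool}

/-- A configuration as a tuple of its components. -/
def Conf.equivProd (M : PTM Bool) :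
    Conf M ≃ M.Q × Option Bool × List (Option Bool) × List (Option Bool) where
  toFun c := (c.state, c.scan, c.left, c.right)
  invFun p := ⟨p.2.2.1, p.2.1, p.2.2.2, p.1⟩

instance (M : PTM Bool) : Fintype M.Q := M.finQ

instance (M : PTM Bool) : Primcodable M.Q := Primcodable.ofEquiv _ (Fintype.equivFin M.Q)

instance (M : PTM Bool) : Primcodable (Conf M) := Primcodable.ofEquiv _ (Conf.equivProd M)

theorem primrec_equivProd : Primrec (Conf.equivProd M) := Primrec.of_equiv

theorem primrec_confState : Primrec (Conf.state : Conf M → M.Q) :=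
  Primrec.fst.comp primrec_equivProd

theorem primrec_confScan : Primrec (Conf.scan : Conf M → _) :=
  Primrec.fst.comp (Primrec.snd.comp primrec_equivProd)

theorem primrec_confLeft : Primrec (Conf.left : Conf M → _) :=
  Primrec.fst.comp (Primrec.snd.comp (Primrec.snd.comp primrec_equivProd))

theorem primrec_confRight : Primrec (Conf.right : Conf M → _) :=
  Primrec.snd.comp (Primrec.snd.comp (Primrec.snd.comp primrec_equivProd))

theorem primrec_confMk {α : Type*} [Primcodable α] {l r : α → List (Option Bool)}
    {a : α → Option Bool} {q : α → M.Q} (hl : Primrec l) (ha : Primrec a) (hr : Primrec r)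
    (hq : Primrec q) : Primrec fun x => (⟨l x, a x, r x, q x⟩ : Conf M) :=
  (Primrec.of_equiv_symm (e := Conf.equivProd M)).comp (hq.pair (ha.pair (hl.pair hr)))

theorem primrec_applyTrans (t : M.Q → Option Bool → M.Q × Option Bool × Move) :
    Primrec (applyTrans t : Conf M → Conf M) := by
  have hqa := primrec_confState.pair (primrec_confScan (M := M))
  have hq := (Primrec.dom_finite fun p : M.Q × Option Bool => (t p.1 p.2).1).comp hqa
  have hb := (Primrec.dom_finite fun p : M.Q × Option Bool => (t p.1 p.2).2.1).comp hqa
  have hd := (Primrec.dom_finite fun p : M.Q × Option Bool =>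
    decide ((t p.1 p.2).2.2 = Move.left)).comp hqa
  have hl := primrec_confLeft (M := M)
  have hr := primrec_confRight (M := M)
  refine (Primrec.cond hd
    (primrec_confMk (Primrec.list_tail.comp hl) (Primrec.list_headI.comp hl)
      (Primrec.list_cons.comp hb hr) hq)
    (primrec_confMk (Primrec.list_cons.comp hb hl) (Primrec.list_headI.comp hr)
      (Primrec.list_tail.comp hr) hq)).of_eq fun c => ?_
  rcases c with ⟨_ | ⟨x, l⟩, a, _ | ⟨y, r⟩, q⟩ <;> rcases h : t q a with ⟨q', b, _ | _⟩ <;>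
    simp [applyTrans, h] <;> rfl

theorem primrec_initConf (M : PTM Bool) : Primrec (initConf M) := by
  have h : Primrec fun s : List Bool => s.map some :=
    Primrec.list_map .id (Primrec.option_some.comp .snd).to₂
  refine (primrec_confMk (M := M) (.const []) (Primrec.list_headI.comp h)
    (Primrec.list_tail.comp h) (.const M.init)).of_eq fun s => ?_
  cases s <;> rfl

theorem primrec_outStr : Primrec (outStr : Conf M → List Bool) :=
  Primrec.listFilterMap (Primrec.list_append.comp (Primrec.list_reverse.comp primrec_confLeft)
    (Primrec.list_cons.comp primrec_confScan primrec_confRight)) Primrec.snd.to₂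

theorem primrecPred_isFinal : PrimrecPred (Conf.IsFinal : Conf M → Prop) :=
  (Primrec.dom_finite fun q : M.Q => decide (q ∈ M.final)).comp primrec_confState |>.primrecPred

theorem primrec_finalOutput : Primrec (finalOutput : Conf M → Option (List Bool)) :=
  .ite primrecPred_isFinal (Primrec.option_some.comp primrec_outStr) (.const none)

theorem primrec_guidedStep : Primrec₂ (guidedStep : Option (Conf M) → Bool → Option (Conf M)) :=
  Primrec.option_bind .fst <| .ite (primrecPred_isFinal.comp .snd) (.const none) <|
    Primrec.option_some.comp <|
      (Primrec.cond (Primrec.snd.comp .fst) ((primrec_applyTrans M.δ₁).comp .snd)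
        ((primrec_applyTrans M.δ₀).comp .snd)).of_eq fun ⟨⟨_, b⟩, _⟩ => by cases b <;> rfl

theorem primrec_guidedRun :
    Primrec₂ (guidedRun : Conf M → List Bool → Option (List Bool)) :=
  Primrec.option_bind (Primrec.list_foldl .snd (Primrec.option_some.comp .fst)
    (primrec_guidedStep.comp (Primrec.fst.comp .snd) (Primrec.snd.comp .snd)).to₂)
    (primrec_finalOutput.comp .snd).to₂

theorem primrec_strNatEquiv : Primrec strNatEquiv := by
  let _ := Encodable.decidableRangeEncode (List Bool)
  have h := (Primrec.list_length.comp (Primrec.listFilter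
    (Primcodable.mem_range_encode (α := List Bool)))).comp
      (Primrec.list_range.comp (Primrec.encode (α := List Bool)))
  refine h.of_eq fun l => ?_
  simp only [← List.countP_eq_length_filter]
  rfl

end Encoding

/-- Some code of the string numbered `n` by `strNatEquiv` is computed from `n` within `PR`. -/
theorem exists_dirac_decode : ∃ G : ℕ → ℕ, PR (dirac fun x : Fin 1 → ℕ => G (x 0)) ∧
    ∀ n, (Encodable.decode (G n) : Option (List Bool)) = some (strNatEquiv.symm n) := by
  let P : ℕ → ℕ → Prop := fun n y =>
    (Encodable.decode y : Option (List Bool)).map strNatEquiv = some n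
  have hP (n : ℕ) : ∃ y, P n y :=
    ⟨Encodable.encode (strNatEquiv.symm n), by simp [P, Encodable.encodek]⟩
  have hPr : PrimrecRel P := Primrec.eq.comp
    (Primrec.option_map (Primrec.decode.comp .snd) (primrec_strNatEquiv.comp .snd).to₂)
    (Primrec.option_some.comp .fst)
  refine ⟨fun n => Nat.find (hP n), ?_, fun n => ?_⟩
  · have hF : Primrec₂ fun n y => if P n y then 0 else 1 := .ite hPr (.const 0) (.const 1)
    rw [← minimize_dirac (F := fun v : Fin 2 → ℕ => if P (v 0) (v 1) then 0 else 1)]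
    · exact (PR.of_primrec₂ hF).minim
    · exact fun x => if_pos (Nat.find_spec (hP (x 0)))
    · intro x z hz
      rw [if_neg]
      · exact one_ne_zero
      · exact Nat.find_min (hP (x 0)) hz
  · obtain ⟨l, hl, hn⟩ := Option.map_eq_some_iff.1 (Nat.find_spec (hP n))
    rw [hl, ← hn, Equiv.symm_apply_apply]

theorem PR.lfpFm (M : PTM Bool) : PR fun (x : Fin 1 → ℕ) y =>
    lfpFm M (initConf M ((Encodable.decode (x 0) : Option (List Bool)).getD []))
      (strNatEquiv.symm y) := by
  let start : ℕ → Conf M := fun x =>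
    initConf M ((Encodable.decode x : Option (List Bool)).getD [])
  let word : ℕ → Option (List Bool) := Encodable.decode₂ (List Bool)
  let run : ℕ → ℕ → Option (List Bool) := fun x y => (word y).bind (guidedRun (start x))
  let m : ℕ → ℕ → ℕ := fun x y =>
    ((run x y).map fun _ => 2 ^ (y - ((word y).getD []).length)).getD 0
  let out : ℕ → ℕ → ℕ := fun x y => ((run x y).map strNatEquiv).getD 0
  have hstart : Primrec start := (primrec_initConf M).comp <|
    Primrec.option_getD.comp Primrec.decode (.const [])
  have hword : Primrec word := Primrec.decode₂
  have hrun : Primrec₂ run := Primrec.option_bind (hword.comp .snd)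
    (primrec_guidedRun.comp (hstart.comp (Primrec.fst.comp .fst)) .snd).to₂
  have hpow : Primrec₂ ((· ^ ·) : ℕ → ℕ → ℕ) := Primrec₂.unpaired'.1 Nat.Primrec.pow
  have hm : Primrec₂ m := Primrec.option_getD.comp (Primrec.option_map hrun
    (hpow.comp (.const 2) <| Primrec.nat_sub.comp (Primrec.snd.comp .fst) <|
      Primrec.list_length.comp <| Primrec.option_getD.comp
        (hword.comp (Primrec.snd.comp .fst)) (.const [])).to₂) (.const 0)
  have hout : Primrec₂ out := Primrec.option_getD.comp (Primrec.option_map hrun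
    (primrec_strNatEquiv.comp .snd).to₂) (.const 0)
  have hrun_encode (x : ℕ) (w : List Bool) :
      run x (Encodable.encode w) = guidedRun (start x) w := by
    simp [run, word]
  have hm_encode (x : ℕ) (w : List Bool) :
      (m x (Encodable.encode w) : ℝ) / 2 ^ Encodable.encode w =
        (if (guidedRun (start x) w).isSome then 1 else 0) * (1 / 2) ^ w.length := by
    have hlen : w.length ≤ Encodable.encode w := Encodable.length_le_encode w
    simp only [m, hrun_encode, word, Encodable.encodek₂, Option.getD_some]
    cases guidedRun (start x) w with
    | none => simp
    | some s =>
      simp only [Option.map_some, Option.getD_some, Option.isSome_some, if_true, one_mul]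
      push_cast
      rw [pow_sub₀ _ two_ne_zero hlen, one_div, inv_pow]
      field_simp
  have hm_range (x : ℕ) {y : ℕ} (hy : y ∉ Set.range (Encodable.encode (α := List Bool))) :
      m x y = 0 := by
    have : word y = none := Option.eq_none_iff_forall_not_mem.2 fun w hw =>
      hy ⟨w, Encodable.mem_decode₂.1 hw⟩
    simp [m, run, this]
  have hinj := Encodable.encode_injective (α := List Bool)
  have hle (x n : ℕ) : ∑ y ∈ Finset.range n, (m x y : ℝ) / 2 ^ y ≤ 1 := by
    have hs : Summable fun y => (m x y : ℝ) / 2 ^ y := by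
      rw [← hinj.summable_iff fun y hy => by simp [hm_range x hy]]
      simpa only [Function.comp_def, hm_encode] using summable_halting (start x)
    refine (hs.sum_le_tsum _ fun y _ => by positivity).trans ?_
    rw [← hinj.tsum_eq]
    · simpa only [hm_encode] using tsum_halting_le_one (start x)
    · exact fun y hy => by_contra fun h => hy (by simp [hm_range x h])
  convert (PR.sample hm hle).bind (PR.of_primrec₂ hout) using 1
  funext v y
  change _ = ∑' z, (if y = out (v 0) z then 1 else 0) * ((m (v 0) z : ℝ) / 2 ^ z)
  generalize v 0 = x
  rw [← hinj.tsum_eq, ← tsum_guidedRun]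
  · refine tsum_congr fun w => ?_
    rw [hm_encode, ← mul_assoc]
    congr 1
    simp only [out, hrun_encode, start]
    cases guidedRun (start x) w with
    | none => simp
    | some s => simp [Equiv.eq_symm_apply, eq_comm]
  · exact fun z hz => by_contra fun h => hz (by simp [hm_range x h])

/-- every probabilistic function computed by a probabilistic Turing
machine is probabilistic recursive, modulo the fixed bijection between ℕ and Σ*:
PC ⊆ PR. -/
theorem PC_subset_PR (f : (Fin 1 → ℕ) → ℕ → ℝ) (hf : PCfun f) : PR f := by
  obtain ⟨M, hM⟩ := hf
  obtain ⟨G, hG, hdec⟩ := exists_dirac_decode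
  have h := (PR.lfpFm M).comp_dirac (G := fun _ x => G (x 0)) fun _ => hG
  convert h using 1
  funext x y
  rw [hM, hdec]
  rfl
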